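/- arXiv:2312.00390 — 3 statements merged into one kernel-verified Lean document; each statement's English description precedes it below -/
import Mathlib

section
/- Let R be a nonzero commutative ring of positive characteristic N = p₁^{α₁}⋯p_s^{α_s}, where p₁,…,p_s are distinct primes and α₁,…,α_s ≥ 1. Let f = Σ_{k=0}^{n} b_k x^k ∈ R[x] be a T-periodic polynomial with b₀ ≠ 0, n = deg(f) ≥ 1, and whose leading coefficient b_n is a unit of R. Then the period satisfies ρ_T(f) = 2·Π_{i=1}^{s} p_i^{α_i + ⌊log_{p_i}(n)⌋}. -/
open Polynomial
open scoped Classical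

/-- The Collatz map on `R[x]`: `T(f) = f·(x+1) − f₀` if the constant coefficient `f₀`
of `f` is nonzero, and `T(f) = f/x` otherwise. -/
noncomputable def collatzT (R : Type*) [CommRing R] (f : R[X]) : R[X] :=
  if f.coeff 0 ≠ 0 then f * (X + 1) - C (f.coeff 0) else f.divX

/-- If `p ^ (a + ⌊log_p n⌋)` divides `m`, then `p ^ a` divides all `m.choose j` with
`1 ≤ j ≤ n`. -/
theorem pow_dvd_choose_of_pow_add_log_dvd {p a n m j : ℕ} (hp : p.Prime)
    (h : p ^ (a + Nat.log p n) ∣ m) (hj : 1 ≤ j) (hjn : j ≤ n) : p ^ a ∣ m.choose j := by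
  obtain ⟨v, c, hc, rfl⟩ := Nat.exists_eq_pow_mul_and_not_dvd (n := j) (by lia) p hp.ne_one
  have hcpos : 0 < c := Nat.pos_of_ne_zero fun h => hc (h ▸ dvd_zero p)
  have hv : v ≤ Nat.log p n :=
    Nat.le_log_of_pow_le hp.one_lt ((Nat.le_mul_of_pos_right _ hcpos).trans hjn)
  have hm : m ∣ m.choose (p ^ v * c) * (p ^ v * c) := by
    rcases m with _ | m
    · simp [Nat.choose_eq_zero_of_lt (show 0 < p ^ v * c from hj)]
    · obtain ⟨i, hi⟩ := Nat.exists_eq_succ_of_ne_zero (show p ^ v * c ≠ 0 by lia)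
      rw [hi]
      exact ⟨_, (Nat.add_one_mul_choose_eq m i).symm⟩
  have hdvd : p ^ v * p ^ a ∣ p ^ v * (m.choose (p ^ v * c) * c) := by
    have h' := ((pow_dvd_pow p (show v + a ≤ a + Nat.log p n by lia)).trans h).trans hm
    rwa [pow_add, mul_left_comm] at h'
  exact (((Nat.Prime.coprime_iff_not_dvd hp).2 hc).pow_left a).dvd_of_dvd_mul_right
    (Nat.dvd_of_mul_dvd_mul_left (pow_pos hp.pos v) hdvd)

/-- If `p` divides `(m + 1).choose k` for `1 ≤ k ≤ j`, then `p` is coprime to `m.choose j`. -/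
theorem not_dvd_choose_of_forall_dvd_choose_succ {p m j : ℕ} (hp : p.Prime)
    (h : ∀ k, 1 ≤ k → k ≤ j → p ∣ (m + 1).choose k) : ¬ p ∣ m.choose j := by
  intro hd
  have hsum := Int.alternating_sum_range_choose_eq_choose (n := m) (m := j)
  rw [Finset.sum_range_succ'] at hsum
  have h1 : (p : ℤ) ∣ (-1) ^ j * (m.choose j : ℤ) :=
    Dvd.dvd.mul_left (Int.natCast_dvd_natCast.2 hd) _
  have h2 : (p : ℤ) ∣ ∑ k ∈ Finset.range j, (-1) ^ (k + 1) * ((m + 1).choose (k + 1) : ℤ) :=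
    Finset.dvd_sum fun k hk => Dvd.dvd.mul_left
      (Int.natCast_dvd_natCast.2 (h _ (by lia) (by simpa using hk))) _
  rw [← hsum] at h1
  have h3 := (dvd_add_right h2).1 h1
  simp only [pow_zero, Nat.choose_zero_right, Nat.cast_one, mul_one] at h3
  exact hp.one_lt.ne' (Nat.dvd_one.1 (Int.natCast_dvd_natCast.1 (by exact_mod_cast h3)))

theorem pow_add_dvd_of_forall_pow_dvd_choose {p a n m : ℕ} (hp : p.Prime) (ha : 1 ≤ a)
    (h : ∀ j, 1 ≤ j → j ≤ n → p ^ a ∣ m.choose j) (i : ℕ) (hi : p ^ i ≤ n) :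
    p ^ (a + i) ∣ m := by
  rcases m with _ | m
  · exact dvd_zero _
  have hpos := pow_pos hp.pos i
  obtain ⟨q, hq⟩ := Nat.exists_eq_succ_of_ne_zero hpos.ne'
  have hq' : p ^ i = q + 1 := hq
  have hnd : ¬ p ∣ m.choose q := not_dvd_choose_of_forall_dvd_choose_succ hp fun k hk hkq =>
    (dvd_pow_self p (by lia)).trans (h k hk (by lia))
  have hdvd : p ^ (a + i) ∣ (m + 1) * m.choose q := by
    rw [Nat.add_one_mul_choose_eq, pow_add, ← hq']
    exact Nat.mul_dvd_mul_right (h _ hpos hi) _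
  exact (((Nat.Prime.coprime_iff_not_dvd hp).2 hnd).pow_left _).dvd_of_dvd_mul_right hdvd

theorem forall_pow_dvd_choose_iff {p a n m : ℕ} (hp : p.Prime) (ha : 1 ≤ a) (hn : 1 ≤ n) :
    (∀ j, 1 ≤ j → j ≤ n → p ^ a ∣ m.choose j) ↔ p ^ (a + Nat.log p n) ∣ m :=
  ⟨fun h => pow_add_dvd_of_forall_pow_dvd_choose hp ha h _ (Nat.pow_log_le_self p (by lia)),
    fun h _ hj hjn => pow_dvd_choose_of_pow_add_log_dvd hp h hj hjn⟩

theorem prod_pow_dvd_iff {ι : Type*} [Fintype ι] {p : ι → ℕ} (hp : ∀ i, (p i).Prime)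
    (hinj : Function.Injective p) (e : ι → ℕ) (m : ℕ) :
    ∏ i, p i ^ e i ∣ m ↔ ∀ i, p i ^ e i ∣ m := by
  refine ⟨fun h i => (Finset.dvd_prod_of_mem _ (Finset.mem_univ i)).trans h, fun h => ?_⟩
  refine Finset.prod_dvd_of_isRelPrime (fun i _ j _ hij => ?_) fun i _ => h i
  exact Nat.coprime_iff_isRelPrime.1
    (Nat.Coprime.pow _ _ ((Nat.coprime_primes (hp i) (hp j)).2 (hinj.ne hij)))

section CollatzStep

variable {R : Type*} [CommRing R]

theorem coeff_iterate_add_divX (f : R[X]) (m i : ℕ) :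
    ((fun g : R[X] => g + g.divX)^[m] f).coeff i =
      ∑ j ∈ Finset.range (m + 1), (m.choose j : R) * f.coeff (i + j) := by
  induction m generalizing i with
  | zero => simp
  | succ m ih =>
    rw [Function.iterate_succ_apply', coeff_add, coeff_divX, ih, ih,
      Finset.sum_choose_succ_mul fun j _ => f.coeff (i + j)]
    simp only [add_right_comm i, add_assoc]

theorem natDegree_iterate_add_divX_le (f : R[X]) (m : ℕ) :
    ((fun g : R[X] => g + g.divX)^[m] f).natDegree ≤ f.natDegree := by
  induction m with
  | zero => rfl
  | succ m ih =>
    rw [Function.iterate_succ_apply']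
    exact (natDegree_add_le_of_degree_le le_rfl natDegree_divX_le).trans ih

theorem iterate_add_divX_eq_self_iff {f : R[X]} (hunit : IsUnit f.leadingCoeff) (m : ℕ) :
    (fun g : R[X] => g + g.divX)^[m] f = f ↔
      ∀ j, 1 ≤ j → j ≤ f.natDegree → (m.choose j : R) = 0 := by
  constructor
  · intro h j
    induction j using Nat.strong_induction_on with
    | _ j ih =>
    intro hj hjn
    have hc := coeff_iterate_add_divX f m (f.natDegree - j)
    rw [h, Finset.sum_eq_add 0 j (by lia)] at hc
    · rw [Nat.sub_add_cancel hjn] at hc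
      have : (m.choose j : R) * f.leadingCoeff = 0 := by
        simpa using hc
      exact (hunit.mul_left_eq_zero).1 this
    · rintro k - ⟨hk0, hkj⟩
      rcases lt_or_gt_of_ne hkj with hlt | hgt
      · rw [ih k hlt (by lia) (by lia), zero_mul]
      · rw [coeff_eq_zero_of_natDegree_lt (by lia), mul_zero]
    · simp
    · intro hjm
      rw [Nat.choose_eq_zero_of_lt (by simpa using hjm), Nat.cast_zero, zero_mul]
  · intro h
    ext i
    rw [coeff_iterate_add_divX, Finset.sum_eq_single 0]
    · simp
    · intro j _ hj
      rcases le_or_gt j f.natDegree with hle | hlt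
      · rw [h j (by lia) hle, zero_mul]
      · rw [coeff_eq_zero_of_natDegree_lt (by lia), mul_zero]
    · simp

theorem coeff_zero_collatzT_of_ne_zero {g : R[X]} (hg : g.coeff 0 ≠ 0) :
    (collatzT R g).coeff 0 = 0 := by
  simp [collatzT, hg, mul_add]

theorem collatzT_collatzT_of_coeff_zero_ne_zero {g : R[X]} (hg : g.coeff 0 ≠ 0) :
    collatzT R (collatzT R g) = g + g.divX := by
  have h : collatzT R (collatzT R g) = (collatzT R g).divX := by
    rw [collatzT, if_neg (not_not.2 (coeff_zero_collatzT_of_ne_zero hg))]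
  rw [h]
  ext i
  simp [collatzT, hg, mul_add, coeff_divX]

theorem collatzT_natDegree_lt_or {n : ℕ} (hn : 1 ≤ n) {g : R[X]}
    (hg : g.natDegree < n ∨ g.coeff 0 = 0 ∧ g.natDegree ≤ n) :
    (collatzT R g).natDegree < n ∨
      (collatzT R g).coeff 0 = 0 ∧ (collatzT R g).natDegree ≤ n := by
  by_cases h0 : g.coeff 0 = 0
  · left
    rw [collatzT, if_neg (not_not.2 h0), natDegree_divX_eq_natDegree_tsub_one]
    lia
  · have hlt : g.natDegree < n := hg.resolve_right fun h => h0 h.1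
    refine Or.inr ⟨coeff_zero_collatzT_of_ne_zero h0, ?_⟩
    rw [collatzT, if_pos h0, natDegree_sub_C]
    refine natDegree_mul_le.trans ?_
    have : (X + 1 : R[X]).natDegree ≤ 1 := by compute_degree
    lia

theorem iterate_two_mul_collatzT_of_periodic {f : R[X]} (h0 : f.coeff 0 ≠ 0)
    (hd : 1 ≤ f.natDegree) (hper : ∃ n ≥ 1, (collatzT R)^[n] f = f) (k : ℕ) :
    (collatzT R)^[2 * k] f = (fun g : R[X] => g + g.divX)^[k] f ∧
      ((fun g : R[X] => g + g.divX)^[k] f).coeff 0 ≠ 0 := by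
  induction k with
  | zero => exact ⟨rfl, h0⟩
  | succ k ih =>
    have heq : (collatzT R)^[2 * (k + 1)] f = (fun g : R[X] => g + g.divX)^[k + 1] f := by
      rw [mul_add, mul_one, Function.iterate_succ_apply', Function.iterate_succ_apply', ih.1,
        collatzT_collatzT_of_coeff_zero_ne_zero ih.2, Function.iterate_succ_apply']
    refine ⟨heq, fun hzero => ?_⟩
    have hinv : ∀ t, ((collatzT R)^[t + 2 * (k + 1)] f).natDegree < f.natDegree ∨
        ((collatzT R)^[t + 2 * (k + 1)] f).coeff 0 = 0 ∧
          ((collatzT R)^[t + 2 * (k + 1)] f).natDegree ≤ f.natDegree := by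
      intro t
      induction t with
      | zero =>
        rw [zero_add, heq]
        exact Or.inr ⟨hzero, natDegree_iterate_add_divX_le f _⟩
      | succ t iht =>
        rw [add_right_comm, Function.iterate_succ_apply']
        exact collatzT_natDegree_lt_or hd iht
    obtain ⟨n, hn, hnf⟩ := hper
    have hmul : (collatzT R)^[n * (2 * (k + 1))] f = f :=
      Function.IsPeriodicPt.mul_const (f := collatzT R) hnf _
    have hle : 2 * (k + 1) ≤ n * (2 * (k + 1)) := Nat.le_mul_of_pos_left _ hn
    have hf := hinv (n * (2 * (k + 1)) - 2 * (k + 1))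
    rw [Nat.sub_add_cancel hle, hmul] at hf
    exact hf.elim (lt_irrefl _) fun h => h0 h.1

theorem minimalPeriod_collatzT_of_periodic {f : R[X]} (h0 : f.coeff 0 ≠ 0)
    (hd : 1 ≤ f.natDegree) (hper : ∃ n ≥ 1, (collatzT R)^[n] f = f) :
    Function.minimalPeriod (collatzT R) f =
      2 * Function.minimalPeriod (fun g : R[X] => g + g.divX) f := by
  have hiter := iterate_two_mul_collatzT_of_periodic h0 hd hper
  refine Nat.dvd_right_iff_eq.1 fun m => ?_
  rw [← Function.isPeriodicPt_iff_minimalPeriod_dvd]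
  rcases Nat.even_or_odd' m with ⟨k, rfl | rfl⟩
  · rw [Nat.mul_dvd_mul_iff_left two_pos, ← Function.isPeriodicPt_iff_minimalPeriod_dvd]
    unfold Function.IsPeriodicPt Function.IsFixedPt
    rw [(hiter k).1]
  · refine iff_of_false (fun h => h0 ?_) fun h => ?_
    · have h' : (collatzT R)^[2 * k + 1] f = f := h
      rw [← h', Function.iterate_succ_apply', (hiter k).1]
      exact coeff_zero_collatzT_of_ne_zero (hiter k).2
    · have := (dvd_mul_right 2 _).trans h
      lia

end CollatzStep

/-- In positive characteristic `N = ∏ pᵢ^αᵢ`, a `T`-periodic polynomial `f` with nonzero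
constant coefficient, `deg f ≥ 1` and unit leading coefficient has period exactly
`2·∏ pᵢ^(αᵢ + ⌊log_{pᵢ}(deg f)⌋)`. -/
theorem stmt3 (R : Type*) [CommRing R] [Nontrivial R] (s : ℕ) (hs : 1 ≤ s)
    (p α : Fin s → ℕ) (hp : ∀ i, (p i).Prime) (hinj : Function.Injective p)
    (hα : ∀ i, 1 ≤ α i) [CharP R (∏ i, p i ^ α i)]
    (f : R[X]) (h0 : f.coeff 0 ≠ 0) (hd : 1 ≤ f.natDegree)
    (hunit : IsUnit f.leadingCoeff)
    (hper : ∃ n ≥ 1, (collatzT R)^[n] f = f) :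
    Function.minimalPeriod (collatzT R) f =
      2 * ∏ i, p i ^ (α i + Nat.log (p i) f.natDegree) := by
  rw [minimalPeriod_collatzT_of_periodic h0 hd hper]
  congr 1
  refine Nat.dvd_right_iff_eq.1 fun m => ?_
  rw [← Function.isPeriodicPt_iff_minimalPeriod_dvd, prod_pow_dvd_iff hp hinj]
  refine (iterate_add_divX_eq_self_iff hunit m).trans ?_
  simp_rw [CharP.cast_eq_zero_iff R (∏ i, p i ^ α i), prod_pow_dvd_iff hp hinj,
    ← forall_pow_dvd_choose_iff (hp _) (hα _) hd]
  exact ⟨fun h i j hj hjn => h j hj hjn i, fun h j hj hjn i => h i j hj hjn⟩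
end

section
/- Let R be a nonzero commutative ring and let f ∈ R[x] be a nonzero T-periodic polynomial. Then f has zero constant coefficient if and only if T(f) has nonzero constant coefficient; moreover, the period ρ_T(f) is even, and the orbit of f contains the same number of polynomials with nonzero constant coefficient as polynomials with zero constant coefficient. -/
open Polynomial
open scoped Classical

theorem collatzT_zero (R : Type*) [CommRing R] : collatzT R 0 = 0 := by
  simp [collatzT]

theorem coeff_zero_collatzT_of_ne_zero_s8 {R : Type*} [CommRing R] {f : R[X]}
    (h : f.coeff 0 ≠ 0) : (collatzT R f).coeff 0 = 0 := by
  simp [collatzT, h, mul_add]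

theorem natDegree_collatzT_of_ne_zero {R : Type*} [CommRing R] [Nontrivial R] {f : R[X]}
    (h : f.coeff 0 ≠ 0) : (collatzT R f).natDegree = f.natDegree + 1 := by
  have hf : f ≠ 0 := by rintro rfl; simp at h
  rw [collatzT, if_pos h, natDegree_sub_C, mul_comm, ← C_1, (monic_X_add_C (1 : R)).natDegree_mul' hf,
    natDegree_X_add_C, add_comm]

theorem natDegree_collatzT_add_one {R : Type*} [CommRing R] {f : R[X]}
    (hf : f ≠ 0) (h : f.coeff 0 = 0) : (collatzT R f).natDegree + 1 = f.natDegree := by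
  have hd : f.natDegree ≠ 0 := by
    intro hd
    apply hf
    rw [eq_C_of_natDegree_eq_zero hd, h, C_0]
  rw [collatzT, if_neg (not_not.mpr h), natDegree_divX_eq_natDegree_tsub_one]
  omega

/-- For a nonzero `T`-periodic polynomial `f`: `f` is even iff `T(f)` is odd, the period
is even, and the orbit of `f` contains as many odd polynomials as even polynomials. -/
theorem stmt8 (R : Type*) [CommRing R] [Nontrivial R] (f : R[X]) (hf : f ≠ 0)
    (hper : ∃ n ≥ 1, (collatzT R)^[n] f = f) :
    (f.coeff 0 = 0 ↔ (collatzT R f).coeff 0 ≠ 0) ∧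
    Even (Function.minimalPeriod (collatzT R) f) ∧
    (((Finset.range (Function.minimalPeriod (collatzT R) f)).image
        fun i => (collatzT R)^[i] f).filter fun g => g.coeff 0 ≠ 0).card =
      (((Finset.range (Function.minimalPeriod (collatzT R) f)).image
        fun i => (collatzT R)^[i] f).filter fun g => g.coeff 0 = 0).card := by
  have hpos : 0 < Function.minimalPeriod (collatzT R) f := by
    obtain ⟨n, hn, h⟩ := hper
    exact Function.IsPeriodicPt.minimalPeriod_pos hn h
  set n := Function.minimalPeriod (collatzT R) f with hn
  have hfn : (collatzT R)^[n] f = f := Function.iterate_minimalPeriod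
  set O := (Finset.range n).image fun i => (collatzT R)^[i] f with hO
  have hmem (i : ℕ) : (collatzT R)^[i] f ∈ O := by
    rw [← Function.iterate_mod_minimalPeriod_eq]
    exact Finset.mem_image.mpr ⟨i % n, Finset.mem_range.mpr (Nat.mod_lt _ hpos), rfl⟩
  have hfO : f ∈ O := hmem 0
  have hcard : O.card = n := by
    rw [hO, Finset.card_image_of_injOn, Finset.card_range]
    intro i hi j hj hij
    exact Function.iterate_injOn_Iio_minimalPeriod (by simpa using hi) (by simpa using hj) hij
  have hmaps : ∀ g ∈ O, collatzT R g ∈ O := by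
    intro g hg
    obtain ⟨i, -, rfl⟩ := Finset.mem_image.mp hg
    rw [← Function.iterate_succ_apply' (collatzT R)]
    exact hmem _
  have hback : ∀ g ∈ O, (collatzT R)^[n] g = g := by
    intro g hg
    obtain ⟨i, -, rfl⟩ := Finset.mem_image.mp hg
    rw [← Function.iterate_add_apply, add_comm, Function.iterate_add_apply, hfn]
  have hinj : Set.InjOn (collatzT R) O := by
    intro a ha b hb hab
    rw [← hback a ha, ← hback b hb]
    obtain ⟨m, hm⟩ := Nat.exists_eq_succ_of_ne_zero hpos.ne'
    rw [hm, Function.iterate_succ_apply, Function.iterate_succ_apply, hab]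
  have hne : ∀ g ∈ O, g ≠ 0 := by
    rintro g hg rfl
    obtain ⟨i, hi, h⟩ := Finset.mem_image.mp hg
    apply hf
    have hi := Finset.mem_range.mp hi
    rw [← hfn, ← Nat.sub_add_cancel hi.le, Function.iterate_add_apply]
    rw [h, Function.iterate_fixed (collatzT_zero R)]
  have himage : O.image (collatzT R) = O :=
    Finset.eq_of_subset_of_card_le (Finset.image_subset_iff.mpr hmaps)
      (Finset.card_image_of_injOn hinj).ge
  have hsum : ∑ g ∈ O, ((collatzT R g).natDegree : ℤ) = ∑ g ∈ O, (g.natDegree : ℤ) := by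
    conv_rhs => rw [← himage, Finset.sum_image hinj]
  have hstep : ∑ g ∈ O, ((collatzT R g).natDegree : ℤ) =
      ∑ g ∈ O, ((g.natDegree : ℤ) + ((if g.coeff 0 ≠ 0 then 1 else 0) -
        (if g.coeff 0 = 0 then 1 else 0))) := by
    refine Finset.sum_congr rfl fun g hg => ?_
    by_cases h : g.coeff 0 = 0
    · have := natDegree_collatzT_add_one (hne g hg) h
      simp [h]
      omega
    · have := natDegree_collatzT_of_ne_zero h
      simp [h]
      omega
  have hbal : (O.filter fun g => g.coeff 0 ≠ 0).card =
      (O.filter fun g => g.coeff 0 = 0).card := by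
    rw [Finset.sum_add_distrib, Finset.sum_sub_distrib, Finset.sum_boole, Finset.sum_boole,
      hsum] at hstep
    omega
  refine ⟨⟨fun h h' => ?_, fun h => ?_⟩, ?_, hbal⟩
  · have hsub : (O.filter fun g => g.coeff 0 ≠ 0).image (collatzT R) ⊆
        O.filter fun g => g.coeff 0 = 0 := by
      intro g hg
      obtain ⟨a, ha, rfl⟩ := Finset.mem_image.mp hg
      obtain ⟨haO, ha⟩ := Finset.mem_filter.mp ha
      exact Finset.mem_filter.mpr ⟨hmaps a haO, coeff_zero_collatzT_of_ne_zero_s8 ha⟩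
    have heq := Finset.eq_of_subset_of_card_le hsub (by
      rw [Finset.card_image_of_injOn (hinj.mono (Finset.coe_subset.mpr (Finset.filter_subset _ _))), hbal])
    have hTf : collatzT R f ∈ O.filter fun g => g.coeff 0 = 0 :=
      Finset.mem_filter.mpr ⟨hmaps f hfO, h'⟩
    rw [← heq] at hTf
    obtain ⟨a, ha, haf⟩ := Finset.mem_image.mp hTf
    obtain ⟨haO, ha⟩ := Finset.mem_filter.mp ha
    exact ha (hinj haO hfO haf ▸ h)
  · by_contra h'
    exact h (coeff_zero_collatzT_of_ne_zero_s8 h')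
  · have := Finset.card_filter_add_card_filter_not (s := O) (fun g => g.coeff 0 = 0)
    rw [← hcard, ← this]
    exact ⟨_, congrArg _ hbal⟩
end

section
/- Let F_q be a finite field of characteristic p and let k ≥ 1. Then the set of polynomials in F_q[x] whose T-period is exactly 2·p^k is finite of cardinality 2·((q−1)^{p^k} − (q−1)^{p^{k−1}}); equivalently, the number of T-cycles of length 2·p^k in F_q[x] equals ((q−1)^{p^k} − (q−1)^{p^{k−1}})/p^k. -/
open Polynomial
open scoped Classical

/-- The shift `f ↦ (f - f₀)/x` as a linear endomorphism of `F[x]`. -/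
noncomputable def divXEnd (F : Type*) [Field F] : Module.End F F[X] where
  toFun := divX
  map_add' _ _ := divX_add
  map_smul' a f := by ext n; simp [coeff_divX]

/-- The operator `1 + divX`, which agrees with `collatzT ∘ collatzT` on polynomials with nonzero
constant coefficient. -/
noncomputable def shiftEnd (F : Type*) [Field F] : Module.End F F[X] := 1 + divXEnd F

section Collatz

variable {F : Type*} [Field F]

lemma coeff_divXEnd_pow (N : ℕ) (f : F[X]) (i : ℕ) :
    ((divXEnd F ^ N) f).coeff i = f.coeff (i + N) := by
  induction N generalizing f with
  | zero => simp
  | succ N ih =>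
    rw [pow_succ, Module.End.mul_apply, ih]
    simp [divXEnd, coeff_divX, add_assoc]

lemma shiftEnd_apply (f : F[X]) : shiftEnd F f = f + f.divX := rfl

lemma shiftEnd_pow_char_pow (p : ℕ) [Fact p.Prime] [CharP F p] (k : ℕ) :
    shiftEnd F ^ p ^ k = 1 + divXEnd F ^ p ^ k := by
  have : CharP (Module.End F F[X]) p :=
    charP_of_injective_algebraMap (algebraMap F (Module.End F F[X])).injective p
  rw [shiftEnd, add_pow_char_pow_of_commute p k (Commute.one_left _), one_pow]

lemma shiftEnd_iterate_char_pow_eq_self_iff (p : ℕ) [Fact p.Prime] [CharP F p] (k : ℕ)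
    (f : F[X]) : (shiftEnd F)^[p ^ k] f = f ↔ f ∈ degreeLT F (p ^ k) := by
  rw [← Module.End.pow_apply, shiftEnd_pow_char_pow p k, LinearMap.add_apply,
    Module.End.one_apply, add_eq_left, mem_degreeLT, degree_lt_iff_coeff_zero]
  constructor
  · intro h m hm
    rw [← Nat.sub_add_cancel hm, ← coeff_divXEnd_pow, h, coeff_zero]
  · intro h
    ext i
    rw [coeff_divXEnd_pow, coeff_zero]
    exact h _ (Nat.le_add_left _ _)

lemma coeff_eq_zero_of_shiftEnd_iterate (n : ℕ) (f : F[X])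
    (h : ∀ m ≤ n, ((shiftEnd F)^[m] f).coeff 0 = 0) : f.coeff n = 0 := by
  induction n generalizing f with
  | zero => exact h 0 le_rfl
  | succ n ih =>
    rw [← coeff_divX]
    refine ih _ fun m hm => ?_
    have hD : f.divX = shiftEnd F f - f := by rw [shiftEnd_apply]; ring
    have h1 := h (m + 1) (by omega)
    have h2 := h m (by omega)
    rw [Function.iterate_succ_apply] at h1
    rw [hD]
    simp only [← Module.End.pow_apply] at *
    rw [map_sub, coeff_sub, h1, h2, sub_zero]

lemma collatzT_of_ne {f : F[X]} (h : f.coeff 0 ≠ 0) :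
    collatzT F f = f * (X + 1) - C (f.coeff 0) := if_pos h

lemma collatzT_of_eq {f : F[X]} (h : f.coeff 0 = 0) : collatzT F f = f.divX :=
  if_neg (not_not.2 h)

lemma collatzT_zero_s12 : collatzT F 0 = 0 := by simp [collatzT]

lemma coeff_zero_collatzT_of_ne {f : F[X]} (h : f.coeff 0 ≠ 0) :
    (collatzT F f).coeff 0 = 0 := by
  rw [collatzT_of_ne h]; simp [mul_add]

lemma collatzT_collatzT {f : F[X]} (h : f.coeff 0 ≠ 0) :
    collatzT F (collatzT F f) = shiftEnd F f := by
  rw [collatzT_of_eq (coeff_zero_collatzT_of_ne h), collatzT_of_ne h, shiftEnd_apply]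
  ext n
  simp [coeff_divX, mul_add, add_comm]

/-- A quantity which never increases along orbits of the Collatz map. -/
noncomputable def collatzHeight (f : F[X]) : ℕ :=
  f.natDegree + if f.coeff 0 = 0 then 0 else 1

lemma collatzHeight_collatzT_of_ne {f : F[X]} (h : f.coeff 0 ≠ 0) :
    collatzHeight (collatzT F f) = collatzHeight f := by
  have hf : f ≠ 0 := by rintro rfl; simp at h
  have h1 : (X + 1 : F[X]) = X + C 1 := by simp
  rw [collatzHeight, if_pos (coeff_zero_collatzT_of_ne h), collatzHeight, if_neg h,
    collatzT_of_ne h, natDegree_sub_C, h1, natDegree_mul hf (X_add_C_ne_zero 1),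
    natDegree_X_add_C, add_zero]

lemma natDegree_pos_of_coeff_zero {f : F[X]} (hf : f ≠ 0) (h : f.coeff 0 = 0) :
    0 < f.natDegree := by
  by_contra h0
  have h0' : f.natDegree = 0 := by omega
  apply hf
  rw [eq_C_of_natDegree_eq_zero h0', h, C_0]

lemma collatzHeight_collatzT_lt {f : F[X]} (hf : f ≠ 0) (h : f.coeff 0 = 0)
    (h' : (collatzT F f).coeff 0 = 0) : collatzHeight (collatzT F f) < collatzHeight f := by
  have := natDegree_pos_of_coeff_zero hf h
  rw [collatzHeight, if_pos h', collatzHeight, if_pos h, collatzT_of_eq h,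
    natDegree_divX_eq_natDegree_tsub_one]
  omega

lemma collatzHeight_collatzT_le (f : F[X]) :
    collatzHeight (collatzT F f) ≤ collatzHeight f := by
  by_cases h : f.coeff 0 = 0
  · by_cases hf : f = 0
    · rw [hf, collatzT_zero_s12]
    · have := natDegree_pos_of_coeff_zero hf h
      rw [collatzHeight, collatzHeight, if_pos h, collatzT_of_eq h,
        natDegree_divX_eq_natDegree_tsub_one]
      split_ifs <;> omega
  · exact (collatzHeight_collatzT_of_ne h).le

lemma collatzHeight_iterate_le (n : ℕ) (f : F[X]) :
    collatzHeight ((collatzT F)^[n] f) ≤ collatzHeight f := by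
  induction n generalizing f with
  | zero => rfl
  | succ n ih => exact (ih _).trans (collatzHeight_collatzT_le f)

lemma coeff_zero_collatzT_ne_of_eq {f : F[X]} (hp : f ∈ Function.periodicPts (collatzT F))
    (hf : f ≠ 0) (h : f.coeff 0 = 0) : (collatzT F f).coeff 0 ≠ 0 := by
  intro h'
  obtain ⟨n, hn, hfn⟩ := hp
  obtain ⟨m, rfl⟩ := Nat.exists_eq_succ_of_ne_zero hn.ne'
  have h1 := collatzHeight_collatzT_lt hf h h'
  have h2 := collatzHeight_iterate_le m (collatzT F f)
  rw [← Function.iterate_succ_apply, hfn.eq] at h2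
  omega

lemma collatzT_ne_zero {f : F[X]} (hp : f ∈ Function.periodicPts (collatzT F))
    (hf : f ≠ 0) : collatzT F f ≠ 0 := by
  intro h
  obtain ⟨n, hn, hfn⟩ := hp
  obtain ⟨m, rfl⟩ := Nat.exists_eq_succ_of_ne_zero hn.ne'
  apply hf
  rw [← hfn.eq, Function.iterate_succ_apply, h]
  exact Function.iterate_fixed collatzT_zero_s12 m

lemma collatzT_mem_periodicPts {f : F[X]} (hp : f ∈ Function.periodicPts (collatzT F)) :
    collatzT F f ∈ Function.periodicPts (collatzT F) :=
  (Function.bijOn_periodicPts (collatzT F)).mapsTo hp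

lemma coeff_zero_shiftEnd_iterate_ne {f : F[X]}
    (hp : f ∈ Function.periodicPts (collatzT F)) (h : f.coeff 0 ≠ 0) (n : ℕ) :
    ((shiftEnd F)^[n] f).coeff 0 ≠ 0 := by
  induction n generalizing f with
  | zero => exact h
  | succ n ih =>
    have hf : f ≠ 0 := by rintro rfl; simp at h
    rw [Function.iterate_succ_apply, ← collatzT_collatzT h]
    have hp' := collatzT_mem_periodicPts hp
    exact ih (collatzT_mem_periodicPts hp') (coeff_zero_collatzT_ne_of_eq hp'
      (collatzT_ne_zero hp hf) (coeff_zero_collatzT_of_ne h))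

lemma collatzT_iterate_two_mul {f : F[X]} (h : ∀ n, ((shiftEnd F)^[n] f).coeff 0 ≠ 0) (n : ℕ) :
    (collatzT F)^[2 * n] f = (shiftEnd F)^[n] f := by
  induction n with
  | zero => rfl
  | succ n ih =>
    rw [show 2 * (n + 1) = 2 * n + 1 + 1 by ring, Function.iterate_succ_apply',
      Function.iterate_succ_apply', ih, collatzT_collatzT (h n), Function.iterate_succ_apply']

lemma minimalPeriod_collatzT {f : F[X]} (h : ∀ n, ((shiftEnd F)^[n] f).coeff 0 ≠ 0) :
    Function.minimalPeriod (collatzT F) f = 2 * Function.minimalPeriod (shiftEnd F) f := by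
  have key : ∀ n, Function.minimalPeriod (collatzT F) f ∣ n ↔
      2 * Function.minimalPeriod (shiftEnd F) f ∣ n := by
    intro n
    rw [← Function.isPeriodicPt_iff_minimalPeriod_dvd]
    obtain ⟨m, rfl | rfl⟩ := Nat.even_or_odd' n
    · rw [Nat.mul_dvd_mul_iff_left two_pos, ← Function.isPeriodicPt_iff_minimalPeriod_dvd,
        Function.IsPeriodicPt, Function.IsPeriodicPt, Function.IsFixedPt, Function.IsFixedPt,
        collatzT_iterate_two_mul h]
    · refine iff_of_false (fun hper => ?_) fun hd => ?_
      · apply h 0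
        have := coeff_zero_collatzT_of_ne (h m)
        rwa [← collatzT_iterate_two_mul h, ← Function.iterate_succ_apply' (collatzT F),
          hper.eq] at this
      · have := (Dvd.intro _ rfl).trans hd
        omega
  exact Nat.dvd_antisymm ((key _).2 dvd_rfl) ((key _).1 dvd_rfl)

/-- The linear map recording the constant coefficients of the first `N` iterates of
`shiftEnd F`. -/
noncomputable def constCoeffs (F : Type*) [Field F] (N : ℕ) : degreeLT F N →ₗ[F] (Fin N → F) :=
  LinearMap.pi fun i => lcoeff F 0 ∘ₗ (shiftEnd F ^ (i : ℕ)) ∘ₗ (degreeLT F N).subtype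

lemma constCoeffs_apply (N : ℕ) (f : degreeLT F N) (i : Fin N) :
    constCoeffs F N f i = ((shiftEnd F)^[i] (f : F[X])).coeff 0 := by
  simp [constCoeffs, Module.End.pow_apply]

lemma constCoeffs_bijective (N : ℕ) : Function.Bijective (constCoeffs F N) := by
  have hinj : Function.Injective (constCoeffs F N) := by
    rw [injective_iff_map_eq_zero]
    intro f hf
    ext n
    rw [ZeroMemClass.coe_zero, coeff_zero]
    by_cases hn : n < N
    · refine coeff_eq_zero_of_shiftEnd_iterate n _ fun m hm => ?_
      rw [← constCoeffs_apply N f ⟨m, hm.trans_lt hn⟩, hf, Pi.zero_apply]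
    · exact (degree_lt_iff_coeff_zero _ _).1 (mem_degreeLT.1 f.2) n (not_lt.1 hn)
  have : FiniteDimensional F (degreeLT F N) :=
    Module.Finite.equiv (degreeLTEquiv F N).symm
  exact ⟨hinj, (LinearMap.injective_iff_surjective_of_finrank_eq_finrank
    (degreeLTEquiv F N).finrank_eq).1 hinj⟩

/-- Polynomials fixed by `(1 + divX)^N` all of whose iterates under `1 + divX` have nonzero
constant coefficient. -/
def goodSet (F : Type*) [Field F] (N : ℕ) : Set F[X] :=
  {f | (∀ n, ((shiftEnd F)^[n] f).coeff 0 ≠ 0) ∧ (shiftEnd F)^[N] f = f}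

lemma goodSet_char_pow_eq_image (p : ℕ) [Fact p.Prime] [CharP F p] (k : ℕ) :
    goodSet F (p ^ k) = (fun f : degreeLT F (p ^ k) => (f : F[X])) ''
      (constCoeffs F (p ^ k) ⁻¹' {v | ∀ i, v i ≠ 0}) := by
  have hpos : 0 < p ^ k := pow_pos (Fact.out : p.Prime).pos k
  ext f
  constructor
  · rintro ⟨h, hf⟩
    refine ⟨⟨f, (shiftEnd_iterate_char_pow_eq_self_iff p k f).1 hf⟩, fun i => ?_, rfl⟩
    rw [constCoeffs_apply]
    exact h i
  · rintro ⟨g, hg, rfl⟩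
    have hfix := (shiftEnd_iterate_char_pow_eq_self_iff p k (g : F[X])).2 g.2
    refine ⟨fun n => ?_, hfix⟩
    have hper : Function.IsPeriodicPt (shiftEnd F) (p ^ k) (g : F[X]) := hfix
    rw [← hper.iterate_mod_apply n]
    have := hg ⟨n % p ^ k, Nat.mod_lt _ hpos⟩
    rwa [constCoeffs_apply] at this

lemma goodSet_char_pow_finite [Fintype F] (p : ℕ) [Fact p.Prime] [CharP F p] (k : ℕ) :
    (goodSet F (p ^ k)).Finite := by
  rw [goodSet_char_pow_eq_image]
  exact ((Set.toFinite _).preimage (constCoeffs_bijective _).injective.injOn).image _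

lemma ncard_goodSet_char_pow [Fintype F] (p : ℕ) [Fact p.Prime] [CharP F p] (k : ℕ) :
    (goodSet F (p ^ k)).ncard = (Fintype.card F - 1) ^ p ^ k := by
  rw [goodSet_char_pow_eq_image, Set.ncard_image_of_injective _ Subtype.val_injective,
    Set.ncard_preimage_of_injective_subset_range (constCoeffs_bijective _).injective
      (by rw [(constCoeffs_bijective _).surjective.range_eq]; exact Set.subset_univ _)]
  have : {v : Fin (p ^ k) → F | ∀ i, v i ≠ 0} =
      (Fintype.piFinset fun _ : Fin (p ^ k) => Finset.univ.erase (0 : F) :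
        Finset (Fin (p ^ k) → F)) := by
    ext v; simp
  rw [this, Set.ncard_coe_finset, Fintype.card_piFinset_const,
    Finset.card_erase_of_mem (Finset.mem_univ _), Finset.card_univ]

lemma setOf_minimalPeriod_coeff_zero_ne (p : ℕ) [Fact p.Prime] (k : ℕ) :
    {f : F[X] | Function.minimalPeriod (collatzT F) f = 2 * p ^ (k + 1) ∧ f.coeff 0 ≠ 0} =
      goodSet F (p ^ (k + 1)) \ goodSet F (p ^ k) := by
  have hp : 0 < p := (Fact.out : p.Prime).pos
  ext f
  constructor
  · rintro ⟨hM, h0⟩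
    have hper : f ∈ Function.periodicPts (collatzT F) := by
      rw [← Function.minimalPeriod_pos_iff_mem_periodicPts, hM]
      positivity
    have h := coeff_zero_shiftEnd_iterate_ne hper h0
    rw [minimalPeriod_collatzT h] at hM
    have hS := Nat.eq_of_mul_eq_mul_left two_pos hM
    refine ⟨⟨h, ?_⟩, fun hg => ?_⟩
    · rw [← hS]; exact Function.iterate_minimalPeriod
    · have hd : Function.minimalPeriod (shiftEnd F) f ∣ p ^ k :=
        Function.IsPeriodicPt.minimalPeriod_dvd hg.2
      rw [hS, Nat.pow_dvd_pow_iff_le_right (Fact.out : p.Prime).one_lt] at hd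
      omega
  · rintro ⟨⟨h, hfix⟩, hn⟩
    refine ⟨?_, h 0⟩
    rw [minimalPeriod_collatzT h,
      Function.minimalPeriod_eq_prime_pow (fun hk => hn ⟨h, hk⟩) hfix]

lemma setOf_minimalPeriod_coeff_zero_eq {N : ℕ} (hN : 1 < N) :
    {f : F[X] | Function.minimalPeriod (collatzT F) f = N ∧ f.coeff 0 = 0} =
      collatzT F '' {f : F[X] | Function.minimalPeriod (collatzT F) f = N ∧ f.coeff 0 ≠ 0} := by
  have hper : ∀ f : F[X], Function.minimalPeriod (collatzT F) f = N →
      f ∈ Function.periodicPts (collatzT F) := fun f hf => by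
    rw [← Function.minimalPeriod_pos_iff_mem_periodicPts, hf]; omega
  have hne : ∀ f : F[X], Function.minimalPeriod (collatzT F) f = N → f ≠ 0 := by
    rintro f hf rfl
    rw [Function.minimalPeriod_eq_one_iff_isFixedPt.2 collatzT_zero_s12] at hf
    omega
  ext g
  constructor
  · rintro ⟨hM, h0⟩
    obtain ⟨f, hf, rfl⟩ := (Function.bijOn_periodicPts (collatzT F)).surjOn (hper g hM)
    rw [Function.minimalPeriod_apply hf] at hM
    exact ⟨f, ⟨hM, fun h => coeff_zero_collatzT_ne_of_eq hf (hne f hM) h h0⟩, rfl⟩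
  · rintro ⟨f, ⟨hM, h0⟩, rfl⟩
    exact ⟨(Function.minimalPeriod_apply (hper f hM)).trans hM, coeff_zero_collatzT_of_ne h0⟩

lemma finite_and_ncard_minimalPeriod [Fintype F] (p : ℕ) [Fact p.Prime] [CharP F p] (k : ℕ) :
    {f : F[X] | Function.minimalPeriod (collatzT F) f = 2 * p ^ (k + 1)}.Finite ∧
    Set.ncard {f : F[X] | Function.minimalPeriod (collatzT F) f = 2 * p ^ (k + 1)} =
      2 * ((Fintype.card F - 1) ^ p ^ (k + 1) - (Fintype.card F - 1) ^ p ^ k) := by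
  have hpos : 0 < p ^ (k + 1) := pow_pos (Fact.out : p.Prime).pos _
  set A := {f : F[X] | Function.minimalPeriod (collatzT F) f = 2 * p ^ (k + 1) ∧ f.coeff 0 ≠ 0}
    with hA
  set B := {f : F[X] | Function.minimalPeriod (collatzT F) f = 2 * p ^ (k + 1) ∧ f.coeff 0 = 0}
    with hB
  have hAB : {f : F[X] | Function.minimalPeriod (collatzT F) f = 2 * p ^ (k + 1)} = A ∪ B := by
    ext f
    simp only [hA, hB, Set.mem_union, Set.mem_ofPred_eq]
    tauto
  have hdisj : Disjoint A B := Set.disjoint_left.2 fun f hf hf' => hf.2 hf'.2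
  have hBA : B = collatzT F '' A := setOf_minimalPeriod_coeff_zero_eq (by omega)
  have hAG : A = goodSet F (p ^ (k + 1)) \ goodSet F (p ^ k) :=
    setOf_minimalPeriod_coeff_zero_ne p k
  have hAfin : A.Finite := hAG ▸ (goodSet_char_pow_finite p (k + 1)).sdiff
  have hBfin : B.Finite := hBA ▸ hAfin.image _
  have hsub : goodSet F (p ^ k) ⊆ goodSet F (p ^ (k + 1)) := fun f hf =>
    ⟨hf.1, Function.IsPeriodicPt.trans_dvd (f := shiftEnd F) hf.2 (pow_dvd_pow p k.le_succ)⟩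
  have hAcard : A.ncard = (Fintype.card F - 1) ^ p ^ (k + 1) - (Fintype.card F - 1) ^ p ^ k := by
    rw [hAG, Set.ncard_sdiff hsub (goodSet_char_pow_finite p k), ncard_goodSet_char_pow,
      ncard_goodSet_char_pow]
  have hinj : Set.InjOn (collatzT F) A := by
    refine (Function.bijOn_periodicPts (collatzT F)).injOn.mono fun f hf => ?_
    rw [← Function.minimalPeriod_pos_iff_mem_periodicPts, hf.1]
    omega
  have hBcard : B.ncard = A.ncard := by rw [hBA, hinj.ncard_image]
  rw [hAB]
  exact ⟨hAfin.union hBfin,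
    by rw [Set.ncard_union_eq hdisj hAfin hBfin, hBcard, hAcard, two_mul]⟩

end Collatz

/-- Over a finite field `F_q` of characteristic `p` and `k ≥ 1`: the set of polynomials of
`T`-period exactly `2·p^k` is finite of cardinality `2·((q−1)^{p^k} − (q−1)^{p^{k−1}})`;
equivalently the number of `T`-cycles of length `2·p^k` is
`((q−1)^{p^k} − (q−1)^{p^{k−1}})/p^k`. -/
theorem stmt12 (F : Type*) [Field F] [Fintype F] (p : ℕ) [Fact p.Prime] [CharP F p]
    (k : ℕ) (hk : 1 ≤ k) :
    {f : F[X] | Function.minimalPeriod (collatzT F) f = 2 * p ^ k}.Finite ∧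
    Set.ncard {f : F[X] | Function.minimalPeriod (collatzT F) f = 2 * p ^ k} =
      2 * ((Fintype.card F - 1) ^ p ^ k - (Fintype.card F - 1) ^ p ^ (k - 1)) ∧
    Set.ncard {f : F[X] | Function.minimalPeriod (collatzT F) f = 2 * p ^ k} / (2 * p ^ k) =
      ((Fintype.card F - 1) ^ p ^ k - (Fintype.card F - 1) ^ p ^ (k - 1)) / p ^ k := by
  obtain ⟨k, rfl⟩ := Nat.exists_eq_add_of_le' hk
  obtain ⟨hfin, hcard⟩ := finite_and_ncard_minimalPeriod (F := F) p k
  rw [Nat.add_sub_cancel]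
  exact ⟨hfin, hcard, by rw [hcard, Nat.mul_div_mul_left _ _ two_pos]⟩
end
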